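/- Combinatorial form of Theorem 4.5: For all constants k, ℓ ≥ 1 there exists a constant C such that every k-ordered tree T with n ≥ 2 nodes whose nodes are labelled from a set of ℓ labels admits a hierarchical definition P in normal form of depth at most C·log₂ n and with at most C·n/log₂ n pairwise inequivalent patterns. -/

import Mathlib

/-- A finite rooted ordered tree, given by its finite, prefix-closed set of node
positions; a position is the list of child directions from the root.  In a
`k`-ordered tree every node has, for each `i : Fin k`, at most one `i`-th child,
which is automatic in this representation. -/
structure PosTree (k : ℕ) where
  nodes : Finset (List (Fin k))
  root_mem : [] ∈ nodes
  prefix_closed : ∀ u v : List (Fin k), u <+: v → v ∈ nodes → u ∈ nodes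

/-- A pattern in a tree: either a subtree pattern (a single node) or a context
pattern (a pair of a node and a proper descendant). -/
inductive Pattern (k : ℕ) : Type
  | subtree : List (Fin k) → Pattern k
  | context : List (Fin k) → List (Fin k) → Pattern k
deriving DecidableEq

/-- Validity of a pattern in a tree `T`: the nodes belong to `T`, and for a
context pattern `(v,w)` the node `w` is a proper descendant of `v`. -/
def Pattern.Valid {k : ℕ} (T : PosTree k) : Pattern k → Prop
  | .subtree v => v ∈ T.nodes
  | .context v w => v ∈ T.nodes ∧ w ∈ T.nodes ∧ v <+: w ∧ v ≠ w

/-- The set `V[p]` of nodes covered by a pattern. -/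
def Pattern.cover {k : ℕ} (T : PosTree k) : Pattern k → Set (List (Fin k))
  | .subtree v => {u | u ∈ T.nodes ∧ v <+: u}
  | .context v w => {u | u ∈ T.nodes ∧ v <+: u ∧ ¬ w <+: u}

/-- A hierarchical definition of `T`: a well-nested set of valid patterns
containing the largest pattern (the root of `T`). -/
structure IsHierDef {k : ℕ} (T : PosTree k) (P : Finset (Pattern k)) : Prop where
  valid : ∀ p ∈ P, p.Valid T
  root_mem : Pattern.subtree ([] : List (Fin k)) ∈ P
  nested : ∀ p ∈ P, ∀ q ∈ P,
    Disjoint (p.cover T) (q.cover T) ∨ p.cover T ⊆ q.cover T ∨ q.cover T ⊆ p.cover T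

/-- `q` is a direct subpattern of `p` (with respect to `P`): `q < p` and no
`r ∈ P` lies strictly between them. -/
def DirectSub {k : ℕ} (T : PosTree k) (P : Finset (Pattern k))
    (q p : Pattern k) : Prop :=
  q ∈ P ∧ p ∈ P ∧ q.cover T ⊂ p.cover T ∧
    ∀ r ∈ P, ¬ (q.cover T ⊂ r.cover T ∧ r.cover T ⊂ p.cover T)

/-- The boundary `∂p`: the nodes covered by `p` but by no direct subpattern. -/
def boundary {k : ℕ} (T : PosTree k) (P : Finset (Pattern k)) (p : Pattern k) :
    Set (List (Fin k)) :=
  p.cover T \ ⋃ q ∈ {q | DirectSub T P q p}, q.cover T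

/-- The size of the branching tree of `p`: the number of boundary nodes plus the
number of direct subpatterns (each direct subpattern is contracted to a single
node). -/
noncomputable def branchSize {k : ℕ} (T : PosTree k) (P : Finset (Pattern k))
    (p : Pattern k) : ℕ :=
  (boundary T P p).ncard + {q | DirectSub T P q p}.ncard

/-- The width of `P` is at most `W`: every branching tree has size at most `W`. -/
def WidthLE {k : ℕ} (T : PosTree k) (P : Finset (Pattern k)) (W : ℕ) : Prop :=
  ∀ p ∈ P, branchSize T P p ≤ W

/-- The depth of `P` (the height of its pattern tree) is at most `d`: every
strictly decreasing chain of patterns of `P` has at most `d + 1` elements. -/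
def DepthLE {k : ℕ} (T : PosTree k) (P : Finset (Pattern k)) (d : ℕ) : Prop :=
  ∀ c : List (Pattern k), (∀ p ∈ c, p ∈ P) →
    c.Chain' (fun p q => q.cover T ⊂ p.cover T) → c.length ≤ d + 1

/-- Equivalence of two patterns `p₁, p₂ ∈ P` of a node-labelled tree: a label-
and order-preserving isomorphism between `(T[p₁], P[p₁])` and `(T[p₂], P[p₂])`,
i.e. a bijection of the covered node sets preserving labels and the `i`-th child
relation and mapping the subpatterns of `p₁` belonging to `P` onto those of
`p₂`. -/
def Equivalent {k ℓ : ℕ} (T : PosTree k) (label : List (Fin k) → Fin ℓ)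
    (P : Finset (Pattern k)) (p₁ p₂ : Pattern k) : Prop :=
  ∃ φ : List (Fin k) → List (Fin k),
    Set.BijOn φ (p₁.cover T) (p₂.cover T) ∧
    (∀ u ∈ p₁.cover T, label (φ u) = label u) ∧
    (∀ u ∈ p₁.cover T, ∀ v ∈ p₁.cover T, ∀ i : Fin k,
       (v = u ++ [i] ↔ φ v = φ u ++ [i])) ∧
    (∀ q ∈ P, q.cover T ⊆ p₁.cover T →
       ∃ q' ∈ P, q'.cover T ⊆ p₂.cover T ∧ φ '' q.cover T = q'.cover T) ∧
    (∀ q' ∈ P, q'.cover T ⊆ p₂.cover T →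
       ∃ q ∈ P, q.cover T ⊆ p₁.cover T ∧ φ '' q.cover T = q'.cover T)

/-- `P` has at most `m` pairwise inequivalent patterns: some set of at most `m`
patterns of `P` meets every equivalence class. -/
def InequivLE {k ℓ : ℕ} (T : PosTree k) (label : List (Fin k) → Fin ℓ)
    (P : Finset (Pattern k)) (m : ℕ) : Prop :=
  ∃ reps : Finset (Pattern k), reps ⊆ P ∧ reps.card ≤ m ∧
    ∀ p ∈ P, ∃ q ∈ reps, Equivalent T label P p q

/-- The root of a pattern. -/
def Pattern.root {k : ℕ} : Pattern k → List (Fin k)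
  | .subtree v => v
  | .context v _ => v

/-- `p` is a subtree pattern. -/
def Pattern.IsSubtree {k : ℕ} : Pattern k → Prop
  | .subtree _ => True
  | .context _ _ => False

/-- The hierarchical definition `(T,P)` is in normal form: every pattern `p ∈ P`
either (1) has boundary exactly the root of `p` and all its direct subpatterns
are subtree patterns, or (2) has exactly two direct subpatterns whose covers
partition the cover of `p`. -/
def NormalForm {k : ℕ} (T : PosTree k) (P : Finset (Pattern k)) : Prop :=
  ∀ p ∈ P,
    (boundary T P p = {p.root} ∧ ∀ q, DirectSub T P q p → q.IsSubtree) ∨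
    (∃ p₁ p₂ : Pattern k, p₁ ≠ p₂ ∧ DirectSub T P p₁ p ∧ DirectSub T P p₂ p ∧
      (∀ q, DirectSub T P q p → q = p₁ ∨ q = p₂) ∧
      Disjoint (p₁.cover T) (p₂.cover T) ∧
      p.cover T = p₁.cover T ∪ p₂.cover T)


/-! ### Codes: relative descriptions of patterns -/

abbrev Code (k : ℕ) (A : Type) := List (Fin k) → Option (Option A)

namespace Code

variable {k : ℕ} {A : Type}

def ss (c : Code k A) : Set (List (Fin k)) := {y | ∃ a, c y = some (some a)}

noncomputable def sz (c : Code k A) : ℕ := (ss c).ncard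

def sub (c : Code k A) (x : List (Fin k)) : Code k A := fun y => c (x ++ y)

open Classical in
noncomputable def top (c : Code k A) (x : List (Fin k)) : Code k A := fun y =>
  if x <+: y then (if y = x then some none else none) else c y

noncomputable def tau (c : Code k A) : ℕ := 2 ^ Nat.log 2 (sz c)

open Classical in
noncomputable def kind (c : Code k A) : ℕ :=
  if ∀ y, c y ≠ some none then
    (if ∃ i, tau c ≤ sz (sub c [i]) then 1 else 0)
  else if ∃ i, c [i] = some none then 2
  else if ∃ i y, c (i :: y) = some none ∧ tau c ≤ sz (sub c [i]) then 4 else 3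

noncomputable def rk (c : Code k A) : ℕ := 5 * Nat.log 2 (sz c) + kind c

structure IsCode (c : Code k A) : Prop where
  root : ∃ a, c [] = some (some a)
  pref : ∀ x y, c (x ++ y) ≠ none → y ≠ [] → ∃ a, c x = some (some a)
  uniq : ∀ h h', c h = some none → c h' = some none → h = h'
  fin : (ss c).Finite

theorem kind_le (c : Code k A) : kind c ≤ 4 := by
  unfold kind; split_ifs <;> omega

theorem ss_sub (c : Code k A) (x : List (Fin k)) :
    (x ++ ·) '' ss (sub c x) = {y | y ∈ ss c ∧ x <+: y} := by
  ext y; constructor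
  · rintro ⟨z, ⟨a, hz⟩, rfl⟩
    exact ⟨⟨a, hz⟩, List.prefix_append _ _⟩
  · rintro ⟨⟨a, hy⟩, ⟨z, rfl⟩⟩
    exact ⟨z, ⟨a, hy⟩, rfl⟩

theorem ss_top (c : Code k A) (x : List (Fin k)) :
    ss (top c x) = {y | y ∈ ss c ∧ ¬ x <+: y} := by
  ext y; simp only [ss, top, Set.mem_ofPred_eq]
  by_cases h : x <+: y
  · by_cases h2 : y = x <;> simp [h, h2]
  · simp [h]

theorem sz_sub (c : Code k A) (x : List (Fin k)) :
    sz (sub c x) = {y | y ∈ ss c ∧ x <+: y}.ncard := by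
  rw [← ss_sub, Set.ncard_image_of_injective _ (List.append_right_injective x)]; rfl

theorem sz_add (c : Code k A) (hc : (ss c).Finite) (x : List (Fin k)) :
    sz (top c x) + sz (sub c x) = sz c := by
  have hf (p : List (Fin k) → Prop) : {y | y ∈ ss c ∧ p y}.Finite := hc.subset fun y h => h.1
  rw [sz_sub, sz, ss_top, sz, ← Set.ncard_union_eq _ (hf _) (hf _)]
  · congr 1; ext y; simp only [Set.mem_union, Set.mem_ofPred_eq]; tauto
  · rw [Set.disjoint_left]; rintro y ⟨_, h⟩ ⟨_, h'⟩; exact h h'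

theorem sub_sub (c : Code k A) (x y : List (Fin k)) : sub (sub c x) y = sub c (x ++ y) := by
  funext z; simp [sub]

theorem IsCode.sz_pos {c : Code k A} (hc : IsCode c) : 0 < sz c :=
  (Set.ncard_pos hc.fin).2 ⟨[], hc.root⟩

theorem IsCode.sz_sub_pos {c : Code k A} (hc : IsCode c) {x : List (Fin k)}
    (hx : ∃ a, c x = some (some a)) : 0 < sz (sub c x) := by
  rw [sz_sub]
  exact (Set.ncard_pos (hc.fin.subset fun y h => h.1)).2 ⟨x, hx, List.prefix_rfl⟩

theorem IsCode.sz_top_pos {c : Code k A} (hc : IsCode c) {x : List (Fin k)}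
    (hx : x ≠ []) : 0 < sz (top c x) := by
  rw [sz, ss_top]
  refine (Set.ncard_pos (hc.fin.subset fun y h => h.1)).2 ⟨[], hc.root, ?_⟩
  simpa using hx

theorem IsCode.sz_sub_le {c : Code k A} (hc : IsCode c) (x : List (Fin k)) :
    sz (sub c x) ≤ sz c := by
  have := sz_add c hc.fin x; omega

theorem IsCode.sz_top_le {c : Code k A} (hc : IsCode c) (x : List (Fin k)) :
    sz (top c x) ≤ sz c := by
  have := sz_add c hc.fin x; omega

theorem IsCode.tau_le {c : Code k A} (hc : IsCode c) : tau c ≤ sz c :=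
  Nat.pow_log_le_self 2 hc.sz_pos.ne'

theorem lt_two_tau (c : Code k A) : sz c < 2 * tau c := by
  have := Nat.lt_pow_succ_log_self (b := 2) (by norm_num) (sz c)
  rw [pow_succ] at this; unfold tau; omega

theorem tau_pos (c : Code k A) : 0 < tau c := by unfold tau; positivity

theorem rk_lt_of_sz {c d : Code k A} (hd : 0 < sz d) (h : sz d < tau c) : rk d < rk c := by
  have h1 : Nat.log 2 (sz d) < Nat.log 2 (sz c) := Nat.log_lt_of_lt_pow (by omega) h
  have := kind_le d
  unfold rk; omega

theorem rk_lt_of_kind {c d : Code k A} (h : sz d ≤ sz c) (h2 : kind d < kind c) :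
    rk d < rk c := by
  have h1 : Nat.log 2 (sz d) ≤ Nat.log 2 (sz c) := Nat.log_mono_right h
  unfold rk; omega

theorem tau_sub_eq {c : Code k A} (hc : IsCode c) {x : List (Fin k)}
    (h : tau c ≤ sz (sub c x)) : tau (sub c x) = tau c := by
  unfold tau
  congr 1
  apply le_antisymm (Nat.log_mono_right (hc.sz_sub_le x))
  apply Nat.le_log_of_pow_le (by norm_num) h

theorem IsCode.pref' {c : Code k A} (hc : IsCode c) {x : List (Fin k)}
    (hh : c x ≠ some none) (h : 0 < sz (sub c x)) : ∃ a, c x = some (some a) := by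
  rw [sz_sub] at h
  obtain ⟨y, ⟨a, hy⟩, ⟨z, rfl⟩⟩ := Set.nonempty_of_ncard_ne_zero h.ne'
  by_cases hz : z = []
  · subst hz; exact ⟨a, by simpa using hy⟩
  · exact hc.pref x z (by simp [hy]) hz

theorem IsCode.exists_max {c : Code k A} (hc : IsCode c) (Q : List (Fin k) → Prop)
    (hQ : ∀ x, Q x → 0 < sz (sub c x)) (x₀ : List (Fin k)) (h₀ : Q x₀) :
    ∃ x, Q x ∧ x₀.length ≤ x.length ∧ ∀ y, Q y → y.length ≤ x.length := by
  obtain ⟨B, hB⟩ : ∃ B, ∀ y ∈ ss c, y.length ≤ B := by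
    obtain ⟨B, hB⟩ := (hc.fin.image List.length).bddAbove
    exact ⟨B, fun y hy => hB ⟨y, hy, rfl⟩⟩
  have hb : ∀ x, Q x → x.length ≤ B := by
    intro x hx
    have h := hQ x hx
    rw [sz_sub] at h
    obtain ⟨y, hy, hxy⟩ := Set.nonempty_of_ncard_ne_zero h.ne'
    exact hxy.length_le.trans (hB y hy)
  have hfin : ({n | ∃ x, Q x ∧ x.length = n} : Set ℕ).Finite :=
    (Set.finite_Iic B).subset (by rintro n ⟨x, hx, rfl⟩; exact hb x hx)
  obtain ⟨n, ⟨x, hx, rfl⟩, hmax⟩ := Set.exists_max_image _ id hfin ⟨_, x₀, h₀, rfl⟩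
  exact ⟨x, hx, hmax _ ⟨x₀, h₀, rfl⟩, fun y hy => hmax _ ⟨y, hy, rfl⟩⟩

def GoodSplit (c : Code k A) : Option (List (Fin k)) → Prop
  | none => (∀ h, c h = some none → ∃ i, h = [i]) ∧
      ∀ i, (∃ a, c [i] = some (some a)) → rk (sub c [i]) < rk c
  | some x => x ≠ [] ∧ (∃ a, c x = some (some a)) ∧ (∀ h, c h = some none → x <+: h) ∧
      rk (sub c x) < rk c ∧ rk (top c x) < rk c

theorem IsCode.exists_split {c : Code k A} (hc : IsCode c) : ∃ o, GoodSplit c o := by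
  have hτ := hc.tau_le
  have hτ2 := lt_two_tau c
  have hτ0 := tau_pos c
  by_cases hh : ∀ y, c y ≠ some none
  · by_cases hi : ∃ i, tau c ≤ sz (sub c [i])
    · obtain ⟨i, hi⟩ := hi
      have hkc : kind c = 1 := by
        unfold kind; rw [if_pos hh, if_pos ⟨i, hi⟩]
      obtain ⟨x, hx, hl, hmax⟩ := hc.exists_max (fun x => tau c ≤ sz (sub c x))
        (fun x hx => by omega) [i] hi
      have hx0 : x ≠ [] := by rintro rfl; simp at hl
      have hxs := hc.pref' (hh x) (by omega)
      refine ⟨some x, hx0, hxs, fun h h' => absurd h' (hh h), ?_, ?_⟩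
      · apply rk_lt_of_kind (hc.sz_sub_le x)
        rw [hkc]
        unfold kind
        have hs : ∀ y, sub c x y ≠ some none := fun y => hh (x ++ y)
        rw [if_pos hs, if_neg]
        · norm_num
        · rintro ⟨j, hj⟩
          rw [tau_sub_eq hc hx, sub_sub] at hj
          have := hmax _ hj
          simp at this
      · apply rk_lt_of_sz (hc.sz_top_pos hx0)
        have := sz_add c hc.fin x; omega
    · refine ⟨none, fun h h' => absurd h' (hh h), fun i hs => ?_⟩
      push Not at hi
      exact rk_lt_of_sz (hc.sz_sub_pos hs) (hi i)
  · have hh' := hh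
    push Not at hh
    obtain ⟨h, hh⟩ := hh
    by_cases hi : ∃ i, c [i] = some none
    · have hkc : kind c = 2 := by
        unfold kind; rw [if_neg hh', if_pos hi]
      obtain ⟨i, hi⟩ := hi
      refine ⟨none, fun h h' => ⟨i, hc.uniq _ _ h' hi⟩, fun j hs => ?_⟩
      apply rk_lt_of_kind (hc.sz_sub_le _)
      rw [hkc]
      unfold kind
      rw [if_pos]
      · split_ifs <;> norm_num
      · intro y hy
        have := hc.uniq _ _ hy hi
        simp at this
        obtain ⟨a, hs⟩ := hs
        rw [this.1, hi] at hs
        simp at hs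
    · have hpref : ∀ x z, h = x ++ z → z ≠ [] → ∃ a, c x = some (some a) := by
        rintro x z rfl hz
        exact hc.pref x z (by simp [hh]) hz
      obtain ⟨i, h', rfl⟩ : ∃ i h', h = i :: h' := by
        cases h with
        | nil => obtain ⟨a, ha⟩ := hc.root; simp [ha] at hh
        | cons i h' => exact ⟨i, h', rfl⟩
      have hh0 : h' ≠ [] := by rintro rfl; exact hi ⟨i, hh⟩
      by_cases hb : tau c ≤ sz (sub c [i])
      · have hkc : kind c = 4 := by
          unfold kind; rw [if_neg hh', if_neg hi, if_pos ⟨i, h', hh, hb⟩]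
        obtain ⟨x, ⟨⟨z, hz0, hz⟩, hx⟩, hl, hmax⟩ := hc.exists_max
          (fun x => (∃ z, z ≠ [] ∧ i :: h' = x ++ z) ∧ tau c ≤ sz (sub c x))
          (fun x hx => by have := hx.2; omega) [i] ⟨⟨h', hh0, rfl⟩, hb⟩
        have hx0 : x ≠ [] := by rintro rfl; simp at hl
        refine ⟨some x, hx0, hpref x z hz hz0, fun g hg => ?_, ?_, ?_⟩
        · rw [hc.uniq _ _ hg hh, hz]; exact List.prefix_append _ _
        · apply rk_lt_of_kind (hc.sz_sub_le x)
          rw [hkc]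
          unfold kind
          rw [if_neg]
          · split_ifs with h1 h2
            · norm_num
            · exfalso
              obtain ⟨j, y, hy, hj⟩ := h2
              rw [tau_sub_eq hc hx, sub_sub] at hj
              have hy0 : y ≠ [] := by rintro rfl; exact h1 ⟨j, hy⟩
              have he : i :: h' = x ++ (j :: y) := (hc.uniq _ _ hy hh).symm
              have := hmax _ ⟨⟨y, hy0, by simpa using he⟩, hj⟩
              simp at this
            · norm_num
          · push Not
            exact ⟨z, by rw [sub, ← hz]; exact hh⟩
        · apply rk_lt_of_sz (hc.sz_top_pos hx0)
          have := sz_add c hc.fin x; omega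
      · have hkc : kind c = 3 := by
          unfold kind; rw [if_neg hh', if_neg hi, if_neg]
          rintro ⟨j, y, hy, hj⟩
          have := hc.uniq _ _ hy hh
          simp at this
          rw [this.1] at hj
          exact hb hj
        have his := hpref [i] h' rfl hh0
        refine ⟨some [i], by simp, his, fun g hg => ?_, ?_, ?_⟩
        · rw [hc.uniq _ _ hg hh]; exact List.prefix_append [i] _
        · exact rk_lt_of_sz (hc.sz_sub_pos his) (by omega)
        · apply rk_lt_of_kind (hc.sz_top_le _)
          have ht : top c [i] [i] = some none := by simp [top]
          rw [hkc]
          unfold kind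
          rw [if_neg, if_pos ⟨i, ht⟩]
          · norm_num
          · push Not
            exact ⟨[i], ht⟩

open Classical in
noncomputable def split (c : Code k A) : Option (List (Fin k)) :=
  if h : ∃ o, GoodSplit c o then h.choose else none

theorem IsCode.good {c : Code k A} (hc : IsCode c) : GoodSplit c (split c) := by
  have h := hc.exists_split
  unfold split
  rw [dif_pos h]
  exact h.choose_spec

/-! Counting codes -/

def Fam (k : ℕ) (B : Type) (s : ℕ) (st : List (List (Fin k))) :
    Set (List (Fin k) → Option B) :=
  {f | {y | f y ≠ none}.Finite ∧ {y | f y ≠ none}.ncard ≤ s ∧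
    ∀ y, f y ≠ none → y ∈ st ∨ ∃ z i, y = z ++ [i] ∧ f z ≠ none}

theorem fam_nil {B : Type} (s : ℕ) : Fam k B s [] ⊆ {fun _ => none} := by
  rintro f ⟨hf, -, h⟩
  have : ∀ n, ∀ y : List (Fin k), y.length = n → f y = none := by
    intro n
    induction n with
    | zero =>
      intro y hy
      by_contra hne
      rcases h y hne with h | ⟨z, i, rfl, -⟩
      · simp at h
      · simp at hy
    | succ n ih =>
      intro y hy
      by_contra hne
      rcases h y hne with h | ⟨z, i, rfl, hz⟩
      · simp at h
      · exact hz (ih z (by simpa using hy))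
  exact funext fun y => this _ y rfl

theorem fam_zero {B : Type} (st : List (List (Fin k))) : Fam k B 0 st ⊆ {fun _ => none} := by
  rintro f ⟨hf, h0, h⟩
  have h1 := (Set.ncard_eq_zero hf).1 (Nat.le_zero.1 h0)
  refine funext fun y => ?_
  by_contra hy
  have : y ∈ {y | f y ≠ none} := hy
  rw [h1] at this
  exact this

theorem fam_cons {B : Type} (s : ℕ) (x : List (Fin k)) (st : List (List (Fin k))) :
    Fam k B (s + 1) (x :: st) ⊆ Fam k B (s + 1) st ∪
      ⋃ a : B, (fun g => Function.update g x (some a)) ''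
        Fam k B s ((List.ofFn fun i => x ++ [i]) ++ st) := by
  rintro f ⟨hf, hs, h⟩
  rcases hx : f x with _ | a
  · left
    refine ⟨hf, hs, fun y hy => ?_⟩
    rcases h y hy with h | h
    · left
      rcases List.mem_cons.1 h with rfl | h
      · exact absurd hx hy
      · exact h
    · exact Or.inr h
  · right
    refine Set.mem_iUnion.2 ⟨a, Function.update f x none, ⟨?_, ?_, ?_⟩, ?_⟩
    · apply hf.subset
      intro y hy
      by_cases hyx : y = x
      · subst hyx; simp at hy
      · simpa [hyx] using hy
    · have : {y | Function.update f x none y ≠ none} = {y | f y ≠ none} \ {x} := by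
        ext y
        by_cases hyx : y = x
        · subst hyx; simp
        · simp [hyx]
      rw [this, Set.ncard_sdiff_singleton_of_mem (by simp [hx])]
      omega
    · intro y hy
      by_cases hyx : y = x
      · subst hyx; simp at hy
      · have hy' : f y ≠ none := by simpa [hyx] using hy
        rcases h y hy' with h | ⟨z, i, rfl, hz⟩
        · left
          rcases List.mem_cons.1 h with rfl | h
          · exact absurd rfl hyx
          · simp [h]
        · by_cases hzx : z = x
          · subst hzx; left; simp [List.mem_ofFn]
          · right; exact ⟨z, i, rfl, by simpa [hzx] using hz⟩
    · simp [← hx]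

theorem fam_bound {B : Type} [Fintype B] [Nonempty B] (s : ℕ) :
    ∀ st, (Fam k B s st).Finite ∧
      (Fam k B s st).ncard ≤ (Fintype.card B * 2 ^ k) ^ s * 2 ^ st.length := by
  have hB : 0 < Fintype.card B := Fintype.card_pos
  have base : ∀ (S : Set (List (Fin k) → Option B)) (N : ℕ), S ⊆ {fun _ => none} → 0 < N →
      S.Finite ∧ S.ncard ≤ N := by
    intro S N h hN
    refine ⟨(Set.finite_singleton _).subset h, ?_⟩
    exact (Set.ncard_le_ncard h (Set.finite_singleton _)).trans (by simp; omega)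
  induction s with
  | zero => intro st; exact base _ _ (fam_zero st) (by positivity)
  | succ s ih =>
    intro st
    induction st with
    | nil => exact base _ _ (fam_nil _) (by positivity)
    | cons x st ih2 =>
      set G := Fam k B s ((List.ofFn fun i => x ++ [i]) ++ st) with hG
      obtain ⟨hf1, hc1⟩ := ih ((List.ofFn fun i => x ++ [i]) ++ st)
      rw [← hG] at hf1 hc1
      obtain ⟨hf2, hc2⟩ := ih2
      have hfU : (⋃ a : B, (fun g => Function.update g x (some a)) '' G).Finite :=
        Set.finite_iUnion fun a => hf1.image _
      have hcU : (⋃ a : B, (fun g => Function.update g x (some a)) '' G).ncard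
          ≤ Fintype.card B * G.ncard := by
        refine (Set.ncard_iUnion_le_of_fintype _).trans ?_
        refine (Finset.sum_le_card_nsmul _ _ G.ncard fun a _ => Set.ncard_image_le hf1).trans ?_
        simp
      refine ⟨(hf2.union hfU).subset (fam_cons s x st), ?_⟩
      refine (Set.ncard_le_ncard (fam_cons s x st) (hf2.union hfU)).trans ?_
      refine (Set.ncard_union_le _ _).trans ?_
      have h3 : Fintype.card B * G.ncard ≤
          (Fintype.card B * 2 ^ k) ^ (s + 1) * 2 ^ st.length := by
        refine (Nat.mul_le_mul_left _ hc1).trans (le_of_eq ?_)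
        simp only [List.length_append, List.length_ofFn]
        ring
      rw [List.length_cons, pow_succ 2 st.length]
      linarith

end Code

/-! ### Abstract laminar families generated by a child relation -/

structure Lam {α β : Type} (cov : α → Set β) (ch : α → α → Prop) (V : α → Prop)
    (rk : α → ℕ) : Prop where
  step : ∀ p q, V p → ch p q → V q ∧ cov q ⊂ cov p ∧ rk q < rk p
  disj : ∀ p q q', V p → ch p q → ch p q' → q ≠ q' → Disjoint (cov q) (cov q')
  ne : ∀ p, V p → (cov p).Nonempty

namespace Lam

variable {α β : Type} {cov : α → Set β} {ch : α → α → Prop} {V : α → Prop} {rk : α → ℕ}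

theorem reach (H : Lam cov ch V rk) {r p : α} (hr : V r) (h : Relation.ReflTransGen ch r p) :
    V p ∧ cov p ⊆ cov r ∧ (p = r ∨ (cov p ⊂ cov r ∧ rk p < rk r)) := by
  induction h with
  | refl => exact ⟨hr, subset_rfl, Or.inl rfl⟩
  | tail h1 h2 ih =>
    obtain ⟨hV, hs, h3⟩ := ih
    obtain ⟨a, b, c⟩ := H.step _ _ hV h2
    refine ⟨a, b.subset.trans hs, Or.inr ?_⟩
    rcases h3 with rfl | ⟨d, e⟩
    · exact ⟨b, c⟩
    · exact ⟨b.trans d, c.trans e⟩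

theorem main (H : Lam cov ch V rk) : ∀ (n : ℕ) (r : α), rk r = n → V r → ∀ p q,
    Relation.ReflTransGen ch r p → Relation.ReflTransGen ch r q →
    Disjoint (cov p) (cov q) ∨ Relation.ReflTransGen ch p q ∨ Relation.ReflTransGen ch q p := by
  intro n
  induction n using Nat.strong_induction_on with
  | _ n ih =>
    intro r hrn hr p q hp hq
    rcases Relation.ReflTransGen.cases_head hp with rfl | ⟨c, hc, hcp⟩
    · exact Or.inr (Or.inl hq)
    rcases Relation.ReflTransGen.cases_head hq with rfl | ⟨c', hc', hcq⟩
    · exact Or.inr (Or.inr hp)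
    obtain ⟨a1, a2, a3⟩ := H.step _ _ hr hc
    obtain ⟨b1, b2, b3⟩ := H.step _ _ hr hc'
    by_cases he : c = c'
    · subst he
      exact ih (rk c) (by omega) c rfl a1 p q hcp hcq
    · left
      exact (H.disj r c c' hr hc hc' he).mono (H.reach a1 hcp).2.1 (H.reach b1 hcq).2.1

theorem nested (H : Lam cov ch V rk) {r p q : α} (hr : V r)
    (hp : Relation.ReflTransGen ch r p) (hq : Relation.ReflTransGen ch r q) :
    Disjoint (cov p) (cov q) ∨ cov p ⊆ cov q ∨ cov q ⊆ cov p := by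
  rcases H.main _ r rfl hr p q hp hq with h | h | h
  · exact Or.inl h
  · exact Or.inr (Or.inr (H.reach (H.reach hr hp).1 h).2.1)
  · exact Or.inr (Or.inl (H.reach (H.reach hr hq).1 h).2.1)

theorem reach_of_subset (H : Lam cov ch V rk) {r p q : α} (hr : V r)
    (hp : Relation.ReflTransGen ch r p) (hq : Relation.ReflTransGen ch r q)
    (hs : cov q ⊆ cov p) : Relation.ReflTransGen ch p q := by
  have hVq := (H.reach hr hq).1
  rcases H.main _ r rfl hr p q hp hq with h | h | h
  · obtain ⟨x, hx⟩ := H.ne q hVq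
    exact absurd hx (Set.disjoint_left.1 h (hs hx))
  · exact h
  · rcases (H.reach hVq h).2.2 with rfl | ⟨h1, -⟩
    · exact Relation.ReflTransGen.refl
    · exact absurd hs h1.not_subset

theorem rk_lt (H : Lam cov ch V rk) {r p q : α} (hr : V r)
    (hp : Relation.ReflTransGen ch r p) (hq : Relation.ReflTransGen ch r q)
    (hs : cov q ⊂ cov p) : rk q < rk p := by
  rcases (H.reach (H.reach hr hp).1 (H.reach_of_subset hr hp hq hs.subset)).2.2 with rfl | h
  · exact absurd hs (ssubset_irrefl _)
  · exact h.2

/-- distinct patterns of the same rank are disjoint -/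
theorem disj_of_rk (H : Lam cov ch V rk) {r p q : α} (hr : V r)
    (hp : Relation.ReflTransGen ch r p) (hq : Relation.ReflTransGen ch r q)
    (he : rk p = rk q) (hne : p ≠ q) : Disjoint (cov p) (cov q) := by
  rcases H.main _ r rfl hr p q hp hq with h | h | h
  · exact h
  · rcases (H.reach (H.reach hr hp).1 h).2.2 with h | h
    · exact absurd h.symm hne
    · omega
  · rcases (H.reach (H.reach hr hq).1 h).2.2 with h | h
    · exact absurd h hne
    · omega

theorem direct_iff (H : Lam cov ch V rk) {r p q : α} (hr : V r)
    (hp : Relation.ReflTransGen ch r p) (hq : Relation.ReflTransGen ch r q) :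
    (cov q ⊂ cov p ∧ ∀ s, Relation.ReflTransGen ch r s → ¬ (cov q ⊂ cov s ∧ cov s ⊂ cov p))
      ↔ ch p q := by
  have hVp := (H.reach hr hp).1
  constructor
  · rintro ⟨h1, h2⟩
    rcases Relation.ReflTransGen.cases_head (H.reach_of_subset hr hp hq h1.subset) with
      rfl | ⟨c, hc, hcq⟩
    · exact absurd h1 (ssubset_irrefl _)
    · obtain ⟨a1, a2, a3⟩ := H.step _ _ hVp hc
      rcases (H.reach a1 hcq).2.2 with rfl | h
      · exact hc
      · exact absurd ⟨h.1, a2⟩ (h2 c (hp.tail hc))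
  · intro h
    refine ⟨(H.step _ _ hVp h).2.1, ?_⟩
    rintro s hs ⟨h1, h2⟩
    rcases Relation.ReflTransGen.cases_head (H.reach_of_subset hr hp hs h2.subset) with
      rfl | ⟨c, hc, hcs⟩
    · exact absurd h2 (ssubset_irrefl _)
    · obtain ⟨a1, a2, a3⟩ := H.step _ _ hVp hc
      have hsc := (H.reach a1 hcs).2.1
      by_cases he : c = q
      · subst he
        exact absurd hsc h1.not_subset
      · have hd := H.disj p c q hVp hc h he
        obtain ⟨x, hx⟩ := H.ne q (H.reach hr hq).1
        exact absurd hx (Set.disjoint_left.1 hd (hsc (h1.subset hx)))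

end Lam

/-! ### Patterns and their codes -/

namespace Pattern

variable {k ℓ : ℕ}

def hole : Pattern k → Option (List (Fin k))
  | .subtree _ => none
  | .context _ w => some w

open Classical in
noncomputable def code (T : PosTree k) (label : List (Fin k) → Fin ℓ) (p : Pattern k) :
    Code k (Fin ℓ) := fun y =>
  if p.root ++ y ∈ p.cover T then some (some (label (p.root ++ y)))
  else if p.hole = some (p.root ++ y) then some none else none

def bot : Pattern k → List (Fin k) → Pattern k
  | .subtree a, x => .subtree (a ++ x)
  | .context a w, x => .context (a ++ x) w

open Code

variable (T : PosTree k) (label : List (Fin k) → Fin ℓ)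

theorem mem_cover_root {p : Pattern k} {u} (hu : u ∈ p.cover T) : p.root <+: u := by
  cases p with
  | subtree a => exact hu.2
  | context a w => exact hu.2.1

theorem mem_ss {p : Pattern k} {y} : y ∈ ss (code T label p) ↔ p.root ++ y ∈ p.cover T := by
  simp only [ss, code, Set.mem_ofPred_eq]
  split_ifs with h1 h2 <;> simp [h1]

theorem cover_eq (p : Pattern k) : p.cover T = (p.root ++ ·) '' ss (code T label p) := by
  ext u
  constructor
  · intro hu
    obtain ⟨y, rfl⟩ := mem_cover_root T hu
    exact ⟨y, (mem_ss T label).2 hu, rfl⟩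
  · rintro ⟨y, hy, rfl⟩
    exact (mem_ss T label).1 hy

theorem cover_finite (p : Pattern k) : (p.cover T).Finite := by
  apply T.nodes.finite_toSet.subset
  cases p <;> exact fun u hu => hu.1

theorem sz_code (p : Pattern k) : sz (code T label p) = (p.cover T).ncard := by
  rw [cover_eq T label, Set.ncard_image_of_injective _ (List.append_right_injective _)]; rfl

theorem code_hole {p : Pattern k} {h} (hh : code T label p h = some none) :
    p.hole = some (p.root ++ h) := by
  unfold code at hh
  split_ifs at hh with h1 h2
  · simp at hh
  · exact h2

theorem isCode {p : Pattern k} (hp : p.Valid T) : IsCode (code T label p) := by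
  refine ⟨?_, ?_, ?_, ?_⟩
  · change [] ∈ ss (code T label p)
    rw [mem_ss]
    cases p with
    | subtree a => exact ⟨by simpa [root] using (show a ∈ T.nodes from hp), by simp [root]⟩
    | context a w =>
      obtain ⟨h1, h2, h3, h4⟩ := hp
      refine ⟨by simpa [root] using h1, by simp [root], fun h => h4 ?_⟩
      simp only [root, List.append_nil] at h
      exact h3.eq_of_length (le_antisymm h3.length_le h.length_le)
  · intro x y h hy
    change x ∈ ss (code T label p)
    rw [mem_ss]
    unfold code at h
    split_ifs at h with h1 h2
    · cases p with
      | subtree a =>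
        exact ⟨T.prefix_closed _ _ ⟨y, by simp⟩ h1.1, by simp [root]⟩
      | context a w =>
        refine ⟨T.prefix_closed _ _ ⟨y, by simp⟩ h1.1, by simp [root], fun h => h1.2.2 ?_⟩
        exact h.trans ⟨y, by simp⟩
    · cases p with
      | subtree a => simp [hole] at h2
      | context a w =>
        simp only [hole, Option.some.injEq, root] at h2
        subst h2
        refine ⟨T.prefix_closed _ _ ⟨y, by simp [root]⟩ hp.2.1, by simp [root], fun h => hy ?_⟩
        simpa [root] using h.length_le
    · exact absurd rfl h
  · intro h h' h1 h2
    have := (code_hole T label h1).symm.trans (code_hole T label h2)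
    simpa using this
  · have : (p.root ++ ·) '' ss (code T label p) = p.cover T := (cover_eq T label p).symm
    exact Set.Finite.of_finite_image (this ▸ cover_finite T p)
      (List.append_right_injective _).injOn

theorem code_subtree {p : Pattern k} {x : List (Fin k)}
    (hh : ∀ w, p.hole = some w → ¬ p.root ++ x <+: w ∧ ¬ w <+: p.root ++ x) :
    code T label (subtree (p.root ++ x)) = sub (code T label p) x := by
  funext y
  cases p with
  | subtree a =>
    simp [code, sub, root, cover, hole]
  | context a w =>
    obtain ⟨h1, h2⟩ := hh w rfl
    simp only [root] at h1 h2
    have h3 : ¬ w <+: a ++ (x ++ y) := by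
      intro h
      rcases List.prefix_or_prefix_of_prefix h (⟨y, by simp⟩ : a ++ x <+: a ++ (x ++ y)) with
        h | h
      · exact h2 h
      · exact h1 h
    have h4 : w ≠ a ++ (x ++ y) := by rintro rfl; exact h3 List.prefix_rfl
    simp [code, sub, root, cover, hole, h3, h4]

theorem code_bot {p : Pattern k} {x : List (Fin k)} :
    code T label (bot p x) = sub (code T label p) x := by
  funext y
  cases p with
  | subtree a => simp [code, sub, root, cover, hole, bot]
  | context a w =>
    have h1 : a <+: a ++ (x ++ y) := ⟨_, rfl⟩
    have h2 : a ++ x <+: a ++ (x ++ y) := ⟨y, by simp⟩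
    simp [code, sub, root, cover, hole, bot, h1, h2]

theorem code_top {p : Pattern k} {x : List (Fin k)}
    (hh : ∀ w, p.hole = some w → p.root ++ x <+: w) :
    code T label (context p.root (p.root ++ x)) = top (code T label p) x := by
  classical
  funext y
  have e : (p.root ++ x = p.root ++ y) = (y = x) := by
    simp [eq_comm]
  by_cases hxy : x <+: y
  · simp [code, top, root, cover, hole, hxy, eq_comm]
  · have hne : x ≠ y := by rintro rfl; exact hxy List.prefix_rfl
    have h1 : p.root <+: p.root ++ y := ⟨_, rfl⟩
    cases p with
    | subtree a =>
      simp [code, top, root, cover, hole, hxy, hne]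
    | context a w =>
      have := hh w rfl
      simp only [root] at this h1
      have h2 : ¬ w <+: a ++ y := by
        intro h
        exact hxy ((List.prefix_append_right_inj a).1 (this.trans h))
      have h3 : w ≠ a ++ y := by rintro rfl; exact h2 List.prefix_rfl
      simp [code, top, root, cover, hole, hxy, hne, h2, h3]

def ch (p q : Pattern k) : Prop :=
  match split (code T label p) with
  | none => ∃ i, (∃ a, code T label p [i] = some (some a)) ∧ q = subtree (p.root ++ [i])
  | some x => q = context p.root (p.root ++ x) ∨ q = bot p x

/-- the relative description of the children of a valid pattern -/
theorem ch_cases {p : Pattern k} (hp : p.Valid T) :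
    (split (code T label p) = none ∧
      (∀ q, ch T label p q ↔ ∃ i, [i] ∈ ss (code T label p) ∧ q = subtree (p.root ++ [i])) ∧
      ∀ i, [i] ∈ ss (code T label p) →
        (subtree (p.root ++ [i])).Valid T ∧
        code T label (subtree (p.root ++ [i])) = sub (code T label p) [i] ∧
        rk (sub (code T label p) [i]) < rk (code T label p)) ∨
    ∃ x, split (code T label p) = some x ∧ x ≠ [] ∧ x ∈ ss (code T label p) ∧
      (∀ q, ch T label p q ↔ q = context p.root (p.root ++ x) ∨ q = bot p x) ∧
      (context p.root (p.root ++ x)).Valid T ∧ (bot p x).Valid T ∧ (bot p x).root = p.root ++ x ∧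
      code T label (context p.root (p.root ++ x)) = top (code T label p) x ∧
      code T label (bot p x) = sub (code T label p) x ∧
      rk (sub (code T label p) x) < rk (code T label p) ∧
      rk (top (code T label p) x) < rk (code T label p) := by
  have hc := isCode T label hp
  have hg := hc.good
  have hT : ∀ u ∈ p.cover T, u ∈ T.nodes := by
    cases p <;> exact fun u hu => hu.1
  have hT0 : p.root ∈ T.nodes := by
    cases p with
    | subtree a => exact hp
    | context a w => exact hp.1
  have hhole : ∀ w, p.hole = some w → ∃ h, w = p.root ++ h ∧ code T label p h = some none := by
    intro w hw
    cases p with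
    | subtree a => simp [hole] at hw
    | context a w' =>
      simp only [hole, Option.some.injEq] at hw
      subst hw
      obtain ⟨h, rfl⟩ := hp.2.2.1
      refine ⟨h, rfl, ?_⟩
      simp [code, cover, hole, root]
  rcases hs : split (code T label p) with _ | x
  · left
    rw [hs] at hg
    obtain ⟨h1, h2⟩ := hg
    refine ⟨rfl, fun q => ?_, fun i hi => ⟨?_, ?_, h2 i hi⟩⟩
    · unfold ch; rw [hs]; rfl
    · exact hT _ ((mem_ss T label).1 hi)
    · apply code_subtree
      intro w hw
      obtain ⟨h, rfl, hh⟩ := hhole w hw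
      obtain ⟨j, rfl⟩ := h1 h hh
      have hij : i ≠ j := by
        rintro rfl
        obtain ⟨a, ha⟩ := hi
        rw [ha] at hh; simp at hh
      simp [hij, hij.symm]
  · right
    rw [hs] at hg
    obtain ⟨h1, h2, h3, h4, h5⟩ := hg
    have hxT : p.root ++ x ∈ T.nodes := hT _ ((mem_ss T label).1 h2)
    refine ⟨x, rfl, h1, h2, fun q => ?_, ⟨hT0, hxT, ⟨x, rfl⟩, by simpa using h1⟩, ?_, ?_, ?_,
      code_bot T label, h4, h5⟩
    · unfold ch; rw [hs]
    · cases p with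
      | subtree a => exact hxT
      | context a w =>
        obtain ⟨h, hh, hh'⟩ := hhole w rfl
        refine ⟨hxT, hp.2.1, ?_, ?_⟩
        · rw [hh]
          exact (List.prefix_append_right_inj _).2 (h3 h hh')
        · rintro rfl
          have : x = h := by simpa [root] using hh
          subst this
          obtain ⟨a, ha⟩ := h2
          rw [ha] at hh'; simp at hh'
    · cases p <;> rfl
    · apply code_top
      intro w hw
      obtain ⟨h, rfl, hh⟩ := hhole w hw
      exact (List.prefix_append_right_inj _).2 (h3 h hh)

theorem cover_of_sub {p q : Pattern k} {x : List (Fin k)} (hr : q.root = p.root ++ x)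
    (hq : code T label q = sub (code T label p) x) :
    q.cover T = (p.root ++ ·) '' {y | y ∈ ss (code T label p) ∧ x <+: y} := by
  rw [cover_eq T label q, hq, ← ss_sub, Set.image_image, hr]
  simp

theorem cover_of_top {p q : Pattern k} {x : List (Fin k)} (hr : q.root = p.root)
    (hq : code T label q = top (code T label p) x) :
    q.cover T = (p.root ++ ·) '' {y | y ∈ ss (code T label p) ∧ ¬ x <+: y} := by
  rw [cover_eq T label q, hq, ss_top, hr]

theorem lam : Lam (fun p : Pattern k => p.cover T) (ch T label) (fun p => p.Valid T)
    (fun p => rk (code T label p)) := by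
  have inj (p : Pattern k) : Function.Injective (p.root ++ ·) := List.append_right_injective p.root
  refine ⟨?_, ?_, ?_⟩
  · intro p q hp hch
    have hc := isCode T label hp
    rcases ch_cases T label hp with ⟨-, h1, h2⟩ | ⟨x, -, hx0, hx, h1, h2, h3, h3', h4, h5, h6, h7⟩
    · obtain ⟨i, hi, rfl⟩ := (h1 q).1 hch
      obtain ⟨a, b, c⟩ := h2 i hi
      refine ⟨a, ?_, by rw [b]; exact c⟩
      show cover T _ ⊂ cover T p
      rw [cover_of_sub T label rfl b, cover_eq T label p]
      apply ((inj p).image_strictMono)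
      refine ⟨fun y hy => hy.1, fun h => ?_⟩
      simpa using (h hc.root).2
    · rcases (h1 q).1 hch with rfl | rfl
      · refine ⟨h2, ?_, by rw [h4]; exact h7⟩
        show cover T _ ⊂ cover T p
        rw [cover_of_top T label (p := p) (q := context p.root (p.root ++ x)) rfl h4, cover_eq T label p]
        apply ((inj p).image_strictMono)
        refine ⟨fun y hy => hy.1, fun h => ?_⟩
        exact (h hx).2 List.prefix_rfl
      · refine ⟨h3, ?_, by rw [h5]; exact h6⟩
        show cover T _ ⊂ cover T p
        rw [cover_of_sub T label h3' h5, cover_eq T label p]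
        apply ((inj p).image_strictMono)
        refine ⟨fun y hy => hy.1, fun h => ?_⟩
        exact hx0 (by simpa using (h hc.root).2)
  · intro p q q' hp hch hch' hne
    have hc := isCode T label hp
    show Disjoint (cover T q) (cover T q')
    rcases ch_cases T label hp with ⟨-, h1, h2⟩ | ⟨x, -, hx0, hx, h1, h2, h3, h3', h4, h5, h6, h7⟩
    · obtain ⟨i, hi, rfl⟩ := (h1 q).1 hch
      obtain ⟨j, hj, rfl⟩ := (h1 q').1 hch'
      rw [cover_of_sub T label rfl (h2 i hi).2.1, cover_of_sub T label rfl (h2 j hj).2.1]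
      apply (Set.disjoint_image_iff (inj p)).2
      rw [Set.disjoint_left]
      rintro y ⟨_, ⟨z, rfl⟩⟩ ⟨_, hz⟩
      have : j = i := by simpa using hz
      exact hne (by rw [this])
    · have key : Disjoint (cover T (context p.root (p.root ++ x))) (cover T (bot p x)) := by
        rw [cover_of_sub T label h3' h5, cover_of_top T label (p := p) (q := context p.root (p.root ++ x)) rfl h4]
        apply (Set.disjoint_image_iff (inj p)).2
        rw [Set.disjoint_left]
        rintro y ⟨_, hy⟩ ⟨_, hz⟩
        exact hy hz
      rcases (h1 q).1 hch with rfl | rfl <;> rcases (h1 q').1 hch' with rfl | rfl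
      · exact absurd rfl hne
      · exact key
      · exact key.symm
      · exact absurd rfl hne
  · intro p hp
    exact ⟨p.root ++ [], (mem_ss T label).1 (isCode T label hp).root⟩

end Pattern

namespace Pattern

open Code

variable {k ℓ : ℕ} (T : PosTree k) (label : List (Fin k) → Fin ℓ)

abbrev Reach (p q : Pattern k) : Prop := Relation.ReflTransGen (ch T label) p q

theorem root_valid : (subtree ([] : List (Fin k))).Valid T := T.root_mem

theorem pset_finite : {q : Pattern k | Reach T label (subtree []) q}.Finite := by
  have h1 : ((subtree '' (T.nodes : Set (List (Fin k)))) ∪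
      Set.image2 context (T.nodes : Set (List (Fin k))) (T.nodes : Set (List (Fin k)))).Finite :=
    (T.nodes.finite_toSet.image _).union (T.nodes.finite_toSet.image2 _ T.nodes.finite_toSet)
  apply h1.subset
  intro q hq
  have hv : q.Valid T := ((lam T label).reach (root_valid T) hq).1
  cases q with
  | subtree a => exact Or.inl ⟨a, hv, rfl⟩
  | context a w => exact Or.inr ⟨a, hv.1, w, hv.2.1, rfl⟩

noncomputable def pset : Finset (Pattern k) := (pset_finite T label).toFinset

theorem mem_pset {q : Pattern k} : q ∈ pset T label ↔ Reach T label (subtree []) q := by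
  simp [pset]

theorem pset_valid {q : Pattern k} (h : q ∈ pset T label) : q.Valid T :=
  ((lam T label).reach (root_valid T) ((mem_pset T label).1 h)).1

theorem pset_hier : IsHierDef T (pset T label) := by
  refine ⟨fun p hp => pset_valid T label hp, (mem_pset T label).2 Relation.ReflTransGen.refl, ?_⟩
  intro p hp q hq
  exact (lam T label).nested (root_valid T) ((mem_pset T label).1 hp) ((mem_pset T label).1 hq)

theorem directSub_iff {p q : Pattern k} (hp : p ∈ pset T label) :
    DirectSub T (pset T label) q p ↔ ch T label p q := by
  have hp' := (mem_pset T label).1 hp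
  constructor
  · rintro ⟨h1, -, h3, h4⟩
    exact ((lam T label).direct_iff (root_valid T) hp' ((mem_pset T label).1 h1)).1
      ⟨h3, fun s hs => h4 s ((mem_pset T label).2 hs)⟩
  · intro h
    have hq : Reach T label (subtree []) q := hp'.tail h
    obtain ⟨h3, h4⟩ := ((lam T label).direct_iff (root_valid T) hp' hq).2 h
    exact ⟨(mem_pset T label).2 hq, hp, h3, fun s hs => h4 s ((mem_pset T label).1 hs)⟩

theorem pset_normal : NormalForm T (pset T label) := by
  intro p hp
  have hv := pset_valid T label hp
  have hc := isCode T label hv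
  rcases ch_cases T label hv with ⟨-, h1, h2⟩ | ⟨x, -, hx0, hx, h1, h2, h3, h3', h4, h5, h6, h7⟩
  · left
    constructor
    · ext u
      simp only [boundary, Set.mem_sdiff, Set.mem_iUnion, Set.mem_singleton_iff, not_exists,
        Set.mem_ofPred_eq, directSub_iff T label hp, h1]
      constructor
      · rintro ⟨hu, hn⟩
        rw [cover_eq T label p] at hu
        obtain ⟨y, hy, rfl⟩ := hu
        cases y with
        | nil => simp
        | cons i y =>
          exfalso
          have hi : [i] ∈ ss (code T label p) := by
            by_cases hy0 : y = []
            · rw [← hy0]; exact hy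
            · obtain ⟨a, ha⟩ := hy
              exact hc.pref [i] y (by simp [ha]) hy0
          apply hn _ ⟨i, hi, rfl⟩
          rw [cover_of_sub T label rfl (h2 i hi).2.1]
          exact ⟨i :: y, ⟨hy, by simp⟩, rfl⟩
      · rintro rfl
        refine ⟨by simpa using (mem_ss T label).1 hc.root, ?_⟩
        rintro q ⟨i, hi, rfl⟩ hm
        have := mem_cover_root T hm
        simpa [root] using this.length_le
    · intro q hq
      rw [directSub_iff T label hp, h1] at hq
      obtain ⟨i, -, rfl⟩ := hq
      trivial
  · right
    have hne : context p.root (p.root ++ x) ≠ bot p x := by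
      intro h
      have := congrArg root h
      rw [h3'] at this
      exact hx0 (by simpa [root] using this)
    refine ⟨context p.root (p.root ++ x), bot p x, hne, ?_, ?_, ?_, ?_, ?_⟩
    · rw [directSub_iff T label hp, h1]; exact Or.inl rfl
    · rw [directSub_iff T label hp, h1]; exact Or.inr rfl
    · intro q hq
      rwa [directSub_iff T label hp, h1] at hq
    · exact (lam T label).disj p _ _ hv ((h1 _).2 (Or.inl rfl)) ((h1 _).2 (Or.inr rfl)) hne
    · rw [cover_of_sub T label h3' h5,
        cover_of_top T label (p := p) (q := context p.root (p.root ++ x)) rfl h4,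
        cover_eq T label p, ← Set.image_union]
      congr 1
      ext y
      simp only [Set.mem_union, Set.mem_ofPred_eq]
      tauto

theorem pset_depth {n : ℕ} (hn : n = T.nodes.card) :
    DepthLE T (pset T label) (5 * Nat.log 2 n + 4) := by
  intro c hc hch
  have key : ∀ c : List (Pattern k), ∀ p, (∀ q ∈ p :: c, q ∈ pset T label) →
      (p :: c).IsChain (fun p q => q.cover T ⊂ p.cover T) →
      (p :: c).length ≤ rk (code T label p) + 1 := by
    intro c
    induction c with
    | nil => intro p _ _; simp
    | cons q c ih =>
      intro p hP hch
      rw [List.isChain_cons_cons] at hch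
      have h1 := ih q (fun r hr => hP r (List.mem_cons_of_mem _ hr)) hch.2
      have h2 := (lam T label).rk_lt (root_valid T)
        ((mem_pset T label).1 (hP p (by simp))) ((mem_pset T label).1 (hP q (by simp))) hch.1
      simp only [List.length_cons] at h1 ⊢
      have h2' : rk (code T label q) < rk (code T label p) := h2
      omega
  cases c with
  | nil => simp
  | cons p c =>
    refine (key c p hc hch).trans ?_
    have h1 : rk (code T label p) ≤ 5 * Nat.log 2 n + 4 := by
      have := kind_le (code T label p)
      have h2 : sz (code T label p) ≤ n := by
        rw [sz_code, hn, ← Set.ncard_coe_finset]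
        apply Set.ncard_le_ncard _ T.nodes.finite_toSet
        cases p <;> exact fun u hu => hu.1
      have h3 := Nat.log_mono_right (b := 2) h2
      unfold rk; omega
    omega

theorem reach_transfer {p q r : Pattern k} (hp : p.Valid T) (hq : q.Valid T)
    (hpq : code T label p = code T label q) (h : Reach T label p r) :
    ∃ r', Reach T label q r' ∧ code T label r = code T label r' ∧
      ∃ x, r.root = p.root ++ x ∧ r'.root = q.root ++ x := by
  induction h with
  | refl => exact ⟨q, .refl, hpq, [], by simp, by simp⟩
  | @tail r s h1 h2 ih =>
    obtain ⟨r', hr', he, x, hx, hx'⟩ := ih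
    have hv : r.Valid T := ((lam T label).reach hp h1).1
    have hv' : r'.Valid T := ((lam T label).reach hq hr').1
    rcases ch_cases T label hv with ⟨e, c1, c2⟩ | ⟨y, e, hy0, hy, c1, c2, c3, c3', c4, c5, c6, c7⟩ <;>
    rcases ch_cases T label hv' with
      ⟨e', d1, d2⟩ | ⟨y', e', hy0', hy', d1, d2, d3, d3', d4, d5, d6, d7⟩
    · obtain ⟨i, hi, rfl⟩ := (c1 s).1 h2
      have hi' := hi
      rw [he] at hi'
      refine ⟨subtree (r'.root ++ [i]), hr'.tail ((d1 _).2 ⟨i, hi', rfl⟩), ?_, x ++ [i], ?_, ?_⟩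
      · rw [(c2 i hi).2.1, (d2 i hi').2.1, he]
      · change r.root ++ [i] = _
        rw [hx, List.append_assoc]
      · change r'.root ++ [i] = _
        rw [hx', List.append_assoc]
    · rw [he, e'] at e; simp at e
    · rw [he, e'] at e; simp at e
    · rw [he, e'] at e
      simp only [Option.some.injEq] at e
      subst e
      rcases (c1 s).1 h2 with rfl | rfl
      · refine ⟨_, hr'.tail ((d1 _).2 (Or.inl rfl)), ?_, x, hx, hx'⟩
        rw [c4, d4, he]
      · refine ⟨_, hr'.tail ((d1 _).2 (Or.inr rfl)), ?_, x ++ y', ?_, ?_⟩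
        · rw [c5, d5, he]
        · rw [c3', hx]; simp
        · rw [d3', hx']; simp

theorem equivalent_of_code {p q : Pattern k} (hp : p ∈ pset T label) (hq : q ∈ pset T label)
    (hpq : code T label p = code T label q) : Equivalent T label (pset T label) p q := by
  have hvp := pset_valid T label hp
  have hvq := pset_valid T label hq
  have hRp := (mem_pset T label).1 hp
  have hRq := (mem_pset T label).1 hq
  set φ : List (Fin k) → List (Fin k) := fun u => q.root ++ u.drop p.root.length with hφ
  have hφa : ∀ y, φ (p.root ++ y) = q.root ++ y := by intro y; simp [hφ]
  have himg : ∀ r r' : Pattern k, ∀ x, r.root = p.root ++ x → r'.root = q.root ++ x →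
      code T label r = code T label r' → φ '' r.cover T = r'.cover T := by
    intro r r' x h1 h2 h3
    rw [cover_eq T label r, cover_eq T label r', ← h3, Set.image_image, h1, h2]
    simp only [List.append_assoc, hφa]
  refine ⟨φ, ⟨?_, ?_, ?_⟩, ?_, ?_, ?_, ?_⟩
  · rw [← himg p q [] (by simp) (by simp) hpq]
    exact Set.mapsTo_image _ _
  · intro u hu v hv h
    obtain ⟨y, rfl⟩ := mem_cover_root T hu
    obtain ⟨z, rfl⟩ := mem_cover_root T hv
    rw [hφa, hφa] at h
    rw [List.append_cancel_left h]
  · rw [← himg p q [] (by simp) (by simp) hpq]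
    exact Set.surjOn_image _ _
  · intro u hu
    obtain ⟨y, rfl⟩ := mem_cover_root T hu
    rw [hφa]
    have h1 := congrFun hpq y
    have hy : q.root ++ y ∈ q.cover T := by
      rw [← mem_ss T label, ← hpq, mem_ss]; exact hu
    simp only [code, if_pos hu, if_pos hy, Option.some.injEq] at h1
    exact h1.symm
  · intro u hu v hv i
    obtain ⟨y, rfl⟩ := mem_cover_root T hu
    obtain ⟨z, rfl⟩ := mem_cover_root T hv
    rw [hφa, hφa]
    simp
  · intro r hr hs
    have hpr := (lam T label).reach_of_subset (root_valid T) hRp ((mem_pset T label).1 hr) hs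
    obtain ⟨r', h1, h2, x, h3, h4⟩ := reach_transfer T label hvp hvq hpq hpr
    exact ⟨r', (mem_pset T label).2 (hRq.trans h1), ((lam T label).reach hvq h1).2.1,
      himg r r' x h3 h4 h2⟩
  · intro r hr hs
    have hpr := (lam T label).reach_of_subset (root_valid T) hRq ((mem_pset T label).1 hr) hs
    obtain ⟨r', h1, h2, x, h3, h4⟩ := reach_transfer T label hvq hvp hpq.symm hpr
    exact ⟨r', (mem_pset T label).2 (hRp.trans h1), ((lam T label).reach hvp h1).2.1,
      himg r' r x h4 h3 h2.symm⟩

/-! ### Counting -/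

theorem sum_rank (r : ℕ) :
    ∑ p ∈ (pset T label).filter (fun p => rk (code T label p) = r), sz (code T label p)
      ≤ T.nodes.card := by
  classical
  set S := (pset T label).filter (fun p => rk (code T label p) = r)
  have h1 : ∀ p, sz (code T label p) = (cover_finite T p).toFinset.card := by
    intro p; rw [sz_code, Set.ncard_eq_toFinset_card _ (cover_finite T p)]
  simp only [h1]
  rw [← Finset.card_biUnion]
  · apply Finset.card_le_card
    intro u hu
    simp only [Finset.mem_biUnion, Set.Finite.mem_toFinset] at hu
    obtain ⟨p, -, hu⟩ := hu
    cases p <;> exact hu.1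
  · intro p hp q hq hne
    simp only [S, Finset.coe_filter, Set.mem_ofPred_eq] at hp hq
    change Disjoint (cover_finite T p).toFinset (cover_finite T q).toFinset
    rw [Set.Finite.disjoint_toFinset]
    exact (lam T label).disj_of_rk (root_valid T) ((mem_pset T label).1 hp.1)
      ((mem_pset T label).1 hq.1) (hp.2.trans hq.2.symm) hne

theorem card_level (i : ℕ) :
    ((pset T label).filter (fun p => Nat.log 2 (sz (code T label p)) = i)).card * 2 ^ i
      ≤ 5 * T.nodes.card := by
  classical
  set S := (pset T label).filter (fun p => Nat.log 2 (sz (code T label p)) = i) with hS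
  have h1 : S.card * 2 ^ i ≤ ∑ p ∈ S, sz (code T label p) := by
    rw [← smul_eq_mul]
    apply Finset.card_nsmul_le_sum
    intro p hp
    simp only [hS, Finset.mem_filter] at hp
    rw [← hp.2]
    exact Nat.pow_log_le_self 2 (isCode T label (pset_valid T label hp.1)).sz_pos.ne'
  have h2 : S ⊆ (Finset.range 5).biUnion fun κ =>
      (pset T label).filter (fun p => rk (code T label p) = 5 * i + κ) := by
    intro p hp
    simp only [hS, Finset.mem_filter] at hp
    simp only [Finset.mem_biUnion, Finset.mem_range, Finset.mem_filter]
    refine ⟨kind (code T label p), ?_, hp.1, ?_⟩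
    · have := kind_le (code T label p); omega
    · unfold rk; rw [hp.2]
  refine h1.trans ((Finset.sum_le_sum_of_subset h2).trans ?_)
  rw [Finset.sum_biUnion]
  swap
  · intro x _ y _ hxy
    change Disjoint (Finset.filter _ _) (Finset.filter _ _)
    rw [Finset.disjoint_filter]
    intro p _ h1 h2
    omega
  refine (Finset.sum_le_card_nsmul _ _ T.nodes.card fun κ _ => sum_rank T label _).trans ?_
  simp

theorem geom_aux (J M : ℕ) (h : J ≤ M) :
    ∑ i ∈ Finset.Ico J M, ((1 : ℝ) / 2) ^ i = 2 * (1 / 2) ^ J - 2 * (1 / 2) ^ M := by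
  induction M, h using Nat.le_induction with
  | base => simp
  | succ M hM ih => rw [Finset.sum_Ico_succ_top hM, ih, pow_succ]; ring

theorem card_large (J : ℕ) :
    (((pset T label).filter (fun p => J ≤ Nat.log 2 (sz (code T label p)))).card : ℝ)
      ≤ 10 * T.nodes.card / 2 ^ J := by
  classical
  set n := T.nodes.card with hn
  set M := max J (Nat.log 2 n + 1)
  have h1 : (pset T label).filter (fun p => J ≤ Nat.log 2 (sz (code T label p))) ⊆
      (Finset.Ico J M).biUnion fun i =>
        (pset T label).filter (fun p => Nat.log 2 (sz (code T label p)) = i) := by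
    intro p hp
    simp only [Finset.mem_filter] at hp
    simp only [Finset.mem_biUnion, Finset.mem_Ico, Finset.mem_filter]
    refine ⟨_, ⟨hp.2, ?_⟩, hp.1, rfl⟩
    have h2 : sz (code T label p) ≤ n := by
      rw [sz_code, hn, ← Set.ncard_coe_finset]
      apply Set.ncard_le_ncard _ T.nodes.finite_toSet
      cases p <;> exact fun u hu => hu.1
    have h3 := Nat.log_mono_right (b := 2) h2
    exact lt_of_lt_of_le (Nat.lt_succ_of_le h3) (le_max_right _ _)
  have h2 := (Finset.card_le_card h1).trans Finset.card_biUnion_le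
  have h3 : ∀ i, (((pset T label).filter
      (fun p => Nat.log 2 (sz (code T label p)) = i)).card : ℝ) ≤ 5 * n * (1 / 2) ^ i := by
    intro i
    have h4 : ((((pset T label).filter
      (fun p => Nat.log 2 (sz (code T label p)) = i)).card * 2 ^ i : ℕ) : ℝ) ≤ (5 * n : ℕ) :=
        Nat.cast_le.2 (card_level T label i)
    push_cast at h4
    rw [one_div, inv_pow, ← div_eq_mul_inv, le_div_iff₀ (by positivity)]
    exact h4
  calc (((pset T label).filter (fun p => J ≤ Nat.log 2 (sz (code T label p)))).card : ℝ)
      ≤ ((∑ i ∈ Finset.Ico J M, ((pset T label).filter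
          (fun p => Nat.log 2 (sz (code T label p)) = i)).card : ℕ) : ℝ) := Nat.cast_le.2 h2
    _ ≤ ∑ i ∈ Finset.Ico J M, 5 * n * ((1 : ℝ) / 2) ^ i := by
        rw [Nat.cast_sum]; exact Finset.sum_le_sum fun i _ => h3 i
    _ = 5 * n * (2 * (1 / 2) ^ J - 2 * (1 / 2) ^ M) := by
        rw [← Finset.mul_sum, geom_aux J M (le_max_left _ _)]
    _ ≤ 5 * n * (2 * (1 / 2) ^ J) := by
        have : (0 : ℝ) ≤ 2 * (1 / 2) ^ M := by positivity
        gcongr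
        linarith
    _ = 10 * n / 2 ^ J := by rw [one_div, inv_pow]; ring

theorem code_mem_fam {p : Pattern k} (hp : p.Valid T) {m : ℕ} (hm : sz (code T label p) < m) :
    code T label p ∈ Fam k (Option (Fin ℓ)) m [[]] := by
  have hc := isCode T label hp
  have hsup : ∃ h, {y | code T label p y ≠ none} ⊆ insert h (ss (code T label p)) := by
    by_cases hh : ∃ h, code T label p h = some none
    · obtain ⟨h, hh⟩ := hh
      refine ⟨h, fun y hy => ?_⟩
      rcases e : code T label p y with _ | _ | a
      · exact absurd e hy
      · exact Or.inl (hc.uniq _ _ e hh)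
      · exact Or.inr ⟨a, e⟩
    · refine ⟨[], fun y hy => ?_⟩
      rcases e : code T label p y with _ | _ | a
      · exact absurd e hy
      · exact absurd ⟨y, e⟩ hh
      · exact Or.inr ⟨a, e⟩
  obtain ⟨h, hsup⟩ := hsup
  refine ⟨(hc.fin.insert h).subset hsup, ?_, ?_⟩
  · refine (Set.ncard_le_ncard hsup (hc.fin.insert h)).trans ?_
    refine (Set.ncard_insert_le _ _).trans ?_
    exact hm
  · intro y hy
    rcases List.eq_nil_or_concat y with rfl | ⟨z, i, rfl⟩
    · simp
    · right
      refine ⟨z, i, by simp, ?_⟩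
      obtain ⟨a, ha⟩ := hc.pref z [i] (by simpa using hy) (by simp)
      simp [ha]

theorem pset_inequiv (J : ℕ) : ∃ m : ℕ,
    (m : ℝ) ≤ 10 * T.nodes.card / 2 ^ J + 2 * (((ℓ + 1) * 2 ^ k : ℕ) : ℝ) ^ (2 ^ J) ∧
    InequivLE T label (pset T label) m := by
  classical
  set L := (pset T label).filter (fun p => J ≤ Nat.log 2 (sz (code T label p)))
  set S := (pset T label).filter (fun p => ¬ J ≤ Nat.log 2 (sz (code T label p)))
  obtain ⟨hf, hcard⟩ := fam_bound (k := k) (B := Option (Fin ℓ)) (2 ^ J) [[]]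
  have hSF : S.image (code T label) ⊆ hf.toFinset := by
    intro c hc
    obtain ⟨p, hp, rfl⟩ := Finset.mem_image.1 hc
    simp only [S, Finset.mem_filter] at hp
    rw [Set.Finite.mem_toFinset]
    apply code_mem_fam T label (pset_valid T label hp.1)
    exact Nat.lt_pow_of_log_lt (by norm_num) (by omega)
  have hS : (S.image (code T label)).card ≤ ((ℓ + 1) * 2 ^ k) ^ (2 ^ J) * 2 := by
    refine (Finset.card_le_card hSF).trans ?_
    rw [← Set.ncard_eq_toFinset_card _ hf]
    simpa using hcard
  have hch : ∀ c ∈ S.image (code T label), ∃ p, p ∈ S ∧ code T label p = c := by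
    intro c hc
    obtain ⟨p, hp, h⟩ := Finset.mem_image.1 hc
    exact ⟨p, hp, h⟩
  have : Nonempty (Pattern k) := ⟨subtree []⟩
  choose! f hf1 hf2 using hch
  refine ⟨L.card + ((ℓ + 1) * 2 ^ k) ^ (2 ^ J) * 2, ?_,
    L ∪ (S.image (code T label)).image f, ?_, ?_, ?_⟩
  · have := card_large T label J
    push_cast at this ⊢
    simp only [L]
    linarith
  · intro p hp
    rcases Finset.mem_union.1 hp with h | h
    · exact (Finset.mem_filter.1 h).1
    · obtain ⟨c, hc, rfl⟩ := Finset.mem_image.1 h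
      exact (Finset.mem_filter.1 (hf1 c hc)).1
  · refine (Finset.card_union_le _ _).trans ?_
    gcongr
    exact Finset.card_image_le.trans hS
  · intro p hp
    by_cases h : J ≤ Nat.log 2 (sz (code T label p))
    · exact ⟨p, Finset.mem_union_left _ (Finset.mem_filter.2 ⟨hp, h⟩),
        equivalent_of_code T label hp hp rfl⟩
    · have hpS : p ∈ S := Finset.mem_filter.2 ⟨hp, h⟩
      have hc := Finset.mem_image_of_mem (code T label) hpS
      refine ⟨f (code T label p), Finset.mem_union_right _ (Finset.mem_image_of_mem f hc), ?_⟩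
      exact equivalent_of_code T label hp (Finset.mem_filter.1 (hf1 _ hc)).1 (hf2 _ hc).symm

end Pattern

/-- Combinatorial form of Theorem 4.5: for all constants `k, ℓ ≥ 1` there exists
a constant `C` such that every `k`-ordered tree with `n ≥ 2` nodes whose nodes
are labelled from a set of `ℓ` labels admits a hierarchical definition in normal
form of depth at most `C·log₂ n` and with at most `C·n/log₂ n` pairwise
inequivalent patterns. -/
theorem stmt9 (k ℓ : ℕ) (hk : 1 ≤ k) (hℓ : 1 ≤ ℓ) :
    ∃ C : ℝ, 0 < C ∧
      ∀ (T : PosTree k) (label : List (Fin k) → Fin ℓ) (n : ℕ),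
        n = T.nodes.card → 2 ≤ n →
        ∃ P : Finset (Pattern k), IsHierDef T P ∧ NormalForm T P ∧
          (∃ d : ℕ, (d : ℝ) ≤ C * Real.logb 2 n ∧ DepthLE T P d) ∧
          (∃ m : ℕ, (m : ℝ) ≤ C * n / Real.logb 2 n ∧ InequivLE T label P m) := by
  set B := (ℓ + 1) * 2 ^ k with hB
  have hB1 : 1 ≤ B := Nat.one_le_iff_ne_zero.2 (by positivity)
  refine ⟨40 * B + 6 * (2 ^ B + 1) + 9, by positivity, ?_⟩
  intro T label n hn hn2
  refine ⟨Pattern.pset T label, Pattern.pset_hier T label, Pattern.pset_normal T label, ?_, ?_⟩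
  all_goals
    set N := Nat.log 2 n with hN
    have hn0 : (0 : ℝ) < n := by exact_mod_cast (by omega : 0 < n)
    have hpow : 2 ^ N ≤ n := Nat.pow_log_le_self 2 (by omega)
    have hpow' : n < 2 ^ (N + 1) := Nat.lt_pow_succ_log_self (by norm_num) n
    have hN1 : 1 ≤ N := Nat.le_log_of_pow_le (by norm_num) (by simpa using hn2)
    have hN1r : (1 : ℝ) ≤ N := by exact_mod_cast hN1
    have hlgN : (N : ℝ) ≤ Real.logb 2 n := by
      rw [Real.le_logb_iff_rpow_le (by norm_num) hn0, Real.rpow_natCast]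
      exact_mod_cast hpow
    have hlgN' : Real.logb 2 n ≤ N + 1 := by
      rw [Real.logb_le_iff_le_rpow (by norm_num) hn0]
      have : ((N : ℝ) + 1) = ((N + 1 : ℕ) : ℝ) := by push_cast; ring
      rw [this, Real.rpow_natCast]
      exact_mod_cast hpow'.le
    set lg := Real.logb 2 (n : ℝ) with hlg
    have hlg1 : 1 ≤ lg := hN1r.trans hlgN
  · refine ⟨5 * N + 4, ?_, Pattern.pset_depth T label hn⟩
    have h1 : (9 : ℝ) ≤ 40 * B + 6 * (2 ^ B + 1) + 9 := by
      have : (0 : ℝ) ≤ 40 * B + 6 * (2 ^ B + 1) := by positivity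
      linarith
    have h2 : 9 * lg ≤ (40 * B + 6 * (2 ^ B + 1) + 9) * lg := by gcongr
    push_cast
    linarith
  · set J := Nat.log 2 (N / (2 * B)) with hJ
    obtain ⟨m, hm, hI⟩ := Pattern.pset_inequiv T label J
    refine ⟨m, ?_, hI⟩
    rw [← hn, ← hB] at hm
    -- size of the cut-off
    have hJ1 : lg ≤ 4 * B * 2 ^ J := by
      have h1 : N / (2 * B) < 2 ^ (J + 1) := Nat.lt_pow_succ_log_self (by norm_num) _
      rw [Nat.div_lt_iff_lt_mul (by omega)] at h1
      have h2 : ((N + 1 : ℕ) : ℝ) ≤ ((2 ^ (J + 1) * (2 * B) : ℕ) : ℝ) := Nat.cast_le.2 h1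
      push_cast at h2
      rw [pow_succ] at h2
      linarith
    set s := Real.sqrt n with hs
    have hss : s * s = n := Real.mul_self_sqrt hn0.le
    have hs1 : 1 ≤ s := by
      rw [hs, Real.one_le_sqrt]; exact_mod_cast (by omega : 1 ≤ n)
    have hsm : (B : ℝ) ^ (2 ^ J) ≤ 2 ^ B + s := by
      have h0 : (B : ℝ) ≤ 2 ^ B := by exact_mod_cast (Nat.lt_two_pow_self (n := B)).le
      have h1 : (B : ℝ) ^ (2 ^ J) ≤ 2 ^ (B * 2 ^ J) := by
        rw [pow_mul]; gcongr
      rcases Nat.eq_zero_or_pos (N / (2 * B)) with h | h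
      · have hJ0 : J = 0 := by rw [hJ, h]; simp
        rw [hJ0] at h1 ⊢
        simp only [pow_zero, mul_one, pow_one] at h1 ⊢
        linarith
      · have h2 : 2 ^ J ≤ N / (2 * B) := Nat.pow_log_le_self 2 h.ne'
        rw [Nat.le_div_iff_mul_le (by omega)] at h2
        have h3 : (2 : ℝ) ^ (B * 2 ^ J) ≤ s := by
          apply Real.le_sqrt_of_sq_le
          rw [← pow_mul]
          have h4 : 2 ^ (B * 2 ^ J * 2) ≤ n :=
            (Nat.pow_le_pow_right (by norm_num) (by linarith)).trans hpow
          exact_mod_cast h4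
        have : (0 : ℝ) ≤ 2 ^ B := by positivity
        linarith
    have hlgs : lg ≤ 3 * s := by
      have h1 : Real.log n = 2 * Real.log s := by
        rw [← hss, Real.log_mul (by positivity) (by positivity)]; ring
      have h2 := Real.log_le_sub_one_of_pos (show 0 < s by linarith)
      have h3 := Real.log_two_gt_d9
      rw [hlg, Real.logb, div_le_iff₀ (by linarith), h1]
      nlinarith
    have hlg0 : 0 < lg := by linarith
    rw [le_div_iff₀ hlg0]
    have e1 : 10 * (n : ℝ) / 2 ^ J * lg ≤ 40 * B * n := by
      rw [div_mul_eq_mul_div, div_le_iff₀ (by positivity)]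
      have := mul_le_mul_of_nonneg_left hJ1 (by positivity : (0 : ℝ) ≤ 10 * n)
      linarith
    have e2 : s * lg ≤ 3 * n := by
      rw [← hss]
      have := mul_le_mul_of_nonneg_left hlgs (by linarith : (0 : ℝ) ≤ s)
      linarith
    have e3 : (B : ℝ) ^ (2 ^ J) ≤ (2 ^ B + 1) * s := by
      have : (2 : ℝ) ^ B * 1 ≤ 2 ^ B * s := by gcongr
      linarith
    have e4 : (B : ℝ) ^ (2 ^ J) * lg ≤ (2 ^ B + 1) * (3 * n) := by
      calc (B : ℝ) ^ (2 ^ J) * lg ≤ (2 ^ B + 1) * s * lg := by gcongr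
        _ = (2 ^ B + 1) * (s * lg) := by ring
        _ ≤ _ := by gcongr
    have e5 : (m : ℝ) * lg ≤ (10 * n / 2 ^ J + 2 * (B : ℝ) ^ (2 ^ J)) * lg := by gcongr
    linarith
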